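/- For all n, r ≥ 1, one has (id_{A^{⊗r}}⊗Δ_{H^{⊗_c n}})∘χ_{n,r} = (χ_{n,r}⊗id_{H^{⊗n}})∘(id_{H^{⊗n}}⊗𝔰_{n,r})∘(Δ_{H^{⊗_c n}}⊗id_{A^{⊗r}}) as maps H^{⊗n}⊗A^{⊗r} → A^{⊗r}⊗H^{⊗n}⊗H^{⊗n}. -/

import Mathlib

/-!
For all `n, r ≥ 1`,
`(id_{A^{⊗r}}⊗Δ_{H^{⊗_c n}})∘χ_{n,r} = (χ_{n,r}⊗id_{H^{⊗n}})∘(id_{H^{⊗n}}⊗𝔰_{n,r})∘(Δ_{H^{⊗_c n}}⊗id_{A^{⊗r}})`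
as maps `H^{⊗n}⊗A^{⊗r} → A^{⊗r}⊗H^{⊗n}⊗H^{⊗n}`.  (Here `pw k H n` denotes `H^{⊗(n+1)}`,
so the statement below, quantified over all `n r : ℕ`, covers exactly all `n, r ≥ 1`.)
-/

open scoped TensorProduct

universe u

variable (k : Type u) [Field k]

/-- A bundled `k`-vector space. -/
structure VS (k : Type u) [Field k] : Type (u + 1) where
  /-- underlying type -/
  carrier : Type u
  [acg : AddCommGroup carrier]
  [mod : Module k carrier]

attribute [instance] VS.acg VS.mod

instance : CoeSort (VS k) (Type u) := ⟨VS.carrier⟩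

/-- Iterated tensor powers: `pw k M n` is `M^{⊗(n+1)}`, right-nested. -/
noncomputable def pw (M : Type u) [AddCommGroup M] [Module k M] : ℕ → VS k
  | 0 => ⟨M⟩
  | n + 1 => ⟨M ⊗[k] ↥(pw M n)⟩

variable {M : Type u} [AddCommGroup M] [Module k M]

/-- The canonical identification `M^{⊗(n+1)} ⊗ M ≅ M^{⊗(n+2)}`. -/
noncomputable def snoc : ∀ n : ℕ, (↥(pw k M n) ⊗[k] M) ≃ₗ[k] ↥(pw k M (n + 1))
  | 0 => LinearEquiv.refl k (M ⊗[k] M)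
  | n + 1 =>
      (TensorProduct.assoc k M ↥(pw k M n) M) ≪≫ₗ
        TensorProduct.congr (LinearEquiv.refl k M) (snoc n)

section Twist

variable {Hh Aa : Type u} [AddCommGroup Hh] [Module k Hh] [AddCommGroup Aa] [Module k Aa]
variable {k}

/-- `t_{1,l}` : the extension of a twisting-type map `t : Hh⊗Aa → Aa⊗Hh` to
`Hh ⊗ Aa^{⊗(l+1)} → Aa^{⊗(l+1)} ⊗ Hh`, via `t_{1,l+1} := (id_{Aa^{⊗l}}⊗t)∘(t_{1,l}⊗id_{Aa})`. -/
noncomputable def tw1 (t : Hh ⊗[k] Aa →ₗ[k] Aa ⊗[k] Hh) :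
    ∀ l : ℕ, (Hh ⊗[k] ↥(pw k Aa l)) →ₗ[k] (↥(pw k Aa l) ⊗[k] Hh)
  | 0 => t
  | l + 1 =>
      LinearMap.rTensor Hh (snoc k l).toLinearMap
        ∘ₗ (TensorProduct.assoc k ↥(pw k Aa l) Aa Hh).symm.toLinearMap
        ∘ₗ LinearMap.lTensor ↥(pw k Aa l) t
        ∘ₗ (TensorProduct.assoc k ↥(pw k Aa l) Hh Aa).toLinearMap
        ∘ₗ LinearMap.rTensor Aa (tw1 t l)
        ∘ₗ (TensorProduct.assoc k Hh ↥(pw k Aa l) Aa).symm.toLinearMap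
        ∘ₗ LinearMap.lTensor Hh (snoc k l).symm.toLinearMap

/-- `t_{j,l}` : the extension of `t` to `Hh^{⊗(j+1)} ⊗ Aa^{⊗(l+1)} → Aa^{⊗(l+1)} ⊗ Hh^{⊗(j+1)}`,
via `t_{j+1,l} := (t_{1,l}⊗id_{Hh^{⊗j}})∘(id_{Hh}⊗t_{j,l})`. -/
noncomputable def twFull (t : Hh ⊗[k] Aa →ₗ[k] Aa ⊗[k] Hh) :
    ∀ (j l : ℕ), (↥(pw k Hh j) ⊗[k] ↥(pw k Aa l)) →ₗ[k] (↥(pw k Aa l) ⊗[k] ↥(pw k Hh j))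
  | 0, l => tw1 t l
  | j + 1, l =>
      (TensorProduct.assoc k ↥(pw k Aa l) Hh ↥(pw k Hh j)).toLinearMap
        ∘ₗ LinearMap.rTensor ↥(pw k Hh j) (tw1 t l)
        ∘ₗ (TensorProduct.assoc k Hh ↥(pw k Aa l) ↥(pw k Hh j)).symm.toLinearMap
        ∘ₗ LinearMap.lTensor Hh (twFull t j l)
        ∘ₗ (TensorProduct.assoc k Hh ↥(pw k Hh j) ↥(pw k Aa l)).toLinearMap

/-- The bijective version of `tw1`, for a bijective `t`. -/
noncomputable def twE1 (t : Hh ⊗[k] Aa ≃ₗ[k] Aa ⊗[k] Hh) :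
    ∀ l : ℕ, (Hh ⊗[k] ↥(pw k Aa l)) ≃ₗ[k] (↥(pw k Aa l) ⊗[k] Hh)
  | 0 => t
  | l + 1 =>
      TensorProduct.congr (LinearEquiv.refl k Hh) (snoc k l).symm
        ≪≫ₗ (TensorProduct.assoc k Hh ↥(pw k Aa l) Aa).symm
        ≪≫ₗ TensorProduct.congr (twE1 t l) (LinearEquiv.refl k Aa)
        ≪≫ₗ TensorProduct.assoc k ↥(pw k Aa l) Hh Aa
        ≪≫ₗ TensorProduct.congr (LinearEquiv.refl k ↥(pw k Aa l)) t
        ≪≫ₗ (TensorProduct.assoc k ↥(pw k Aa l) Aa Hh).symm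
        ≪≫ₗ TensorProduct.congr (snoc k l) (LinearEquiv.refl k Hh)

/-- The bijective version of `twFull`, for a bijective `t`. -/
noncomputable def twEFull (t : Hh ⊗[k] Aa ≃ₗ[k] Aa ⊗[k] Hh) :
    ∀ (j l : ℕ), (↥(pw k Hh j) ⊗[k] ↥(pw k Aa l)) ≃ₗ[k] (↥(pw k Aa l) ⊗[k] ↥(pw k Hh j))
  | 0, l => twE1 t l
  | j + 1, l =>
      TensorProduct.assoc k Hh ↥(pw k Hh j) ↥(pw k Aa l)
        ≪≫ₗ TensorProduct.congr (LinearEquiv.refl k Hh) (twEFull t j l)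
        ≪≫ₗ (TensorProduct.assoc k Hh ↥(pw k Aa l) ↥(pw k Hh j)).symm
        ≪≫ₗ TensorProduct.congr (twE1 t l) (LinearEquiv.refl k ↥(pw k Hh j))
        ≪≫ₗ TensorProduct.assoc k ↥(pw k Aa l) Hh ↥(pw k Hh j)

end Twist

section Action

variable {Hh Aa : Type u} [AddCommGroup Hh] [Module k Hh] [AddCommGroup Aa] [Module k Aa]
variable {k}

/-- `ρ_l` : the extension `ρ_{l+1} := (ρ_l⊗ρ)∘(id_{Hh}⊗𝔰_{1,l}⊗id_{Aa})∘(Δ⊗id)` of a weak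
action `ρ` to `Hh ⊗ Aa^{⊗(l+1)} → Aa^{⊗(l+1)}`. -/
noncomputable def rhoPow (Δ : Hh →ₗ[k] Hh ⊗[k] Hh) (s : Hh ⊗[k] Aa ≃ₗ[k] Aa ⊗[k] Hh)
    (ρ : Hh ⊗[k] Aa →ₗ[k] Aa) :
    ∀ l : ℕ, (Hh ⊗[k] ↥(pw k Aa l)) →ₗ[k] ↥(pw k Aa l)
  | 0 => ρ
  | l + 1 =>
      (snoc k l).toLinearMap
        ∘ₗ TensorProduct.map (rhoPow Δ s ρ l) ρ
        ∘ₗ (TensorProduct.assoc k Hh ↥(pw k Aa l) (Hh ⊗[k] Aa)).symm.toLinearMap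
        ∘ₗ LinearMap.lTensor Hh (TensorProduct.assoc k ↥(pw k Aa l) Hh Aa).toLinearMap
        ∘ₗ LinearMap.lTensor Hh (LinearMap.rTensor Aa (twE1 s l).toLinearMap)
        ∘ₗ LinearMap.lTensor Hh (TensorProduct.assoc k Hh ↥(pw k Aa l) Aa).symm.toLinearMap
        ∘ₗ (TensorProduct.assoc k Hh Hh (↥(pw k Aa l) ⊗[k] Aa)).toLinearMap
        ∘ₗ LinearMap.rTensor (↥(pw k Aa l) ⊗[k] Aa) Δ
        ∘ₗ LinearMap.lTensor Hh (snoc k l).symm.toLinearMap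

/-- `ρ_{j,l}` : the extension `ρ_{j+1,l} := ρ_{1,l}∘(id_{Hh}⊗ρ_{j,l})`. -/
noncomputable def rhoFull (Δ : Hh →ₗ[k] Hh ⊗[k] Hh) (s : Hh ⊗[k] Aa ≃ₗ[k] Aa ⊗[k] Hh)
    (ρ : Hh ⊗[k] Aa →ₗ[k] Aa) :
    ∀ (j l : ℕ), (↥(pw k Hh j) ⊗[k] ↥(pw k Aa l)) →ₗ[k] ↥(pw k Aa l)
  | 0, l => rhoPow Δ s ρ l
  | j + 1, l =>
      rhoPow Δ s ρ l
        ∘ₗ LinearMap.lTensor Hh (rhoFull Δ s ρ j l)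
        ∘ₗ (TensorProduct.assoc k Hh ↥(pw k Hh j) ↥(pw k Aa l)).toLinearMap

end Action

section ComulPow

variable {Hh : Type u} [AddCommGroup Hh] [Module k Hh]
variable {k}

/-- `Δ^{⊗(n+1)} : Hh^{⊗(n+1)} → (Hh⊗Hh)^{⊗(n+1)}`. -/
noncomputable def dPow (Δ : Hh →ₗ[k] Hh ⊗[k] Hh) :
    ∀ n : ℕ, ↥(pw k Hh n) →ₗ[k] ↥(pw k (Hh ⊗[k] Hh) n)
  | 0 => Δ
  | n + 1 => TensorProduct.map Δ (dPow Δ n)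

/-- `id_{Hh} ⊗ c^{×(n+1)} ⊗ id_{Hh}` : the simultaneous application of `c` to the `n+1`
consecutive interior pairs of tensor factors of `(Hh⊗Hh)^{⊗(n+2)}`. -/
noncomputable def mids (c : Hh ⊗[k] Hh →ₗ[k] Hh ⊗[k] Hh) :
    ∀ n : ℕ, ↥(pw k (Hh ⊗[k] Hh) (n + 1)) →ₗ[k] (Hh ⊗[k] (↥(pw k (Hh ⊗[k] Hh) n) ⊗[k] Hh))
  | 0 =>
      LinearMap.lTensor Hh (LinearMap.rTensor Hh c)
        ∘ₗ LinearMap.lTensor Hh (TensorProduct.assoc k Hh Hh Hh).symm.toLinearMap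
        ∘ₗ (TensorProduct.assoc k Hh Hh (Hh ⊗[k] Hh)).toLinearMap
  | n + 1 =>
      LinearMap.lTensor Hh
          (TensorProduct.assoc k (Hh ⊗[k] Hh) ↥(pw k (Hh ⊗[k] Hh) n) Hh).symm.toLinearMap
        ∘ₗ LinearMap.lTensor Hh (LinearMap.rTensor (↥(pw k (Hh ⊗[k] Hh) n) ⊗[k] Hh) c)
        ∘ₗ LinearMap.lTensor Hh
            (TensorProduct.assoc k Hh Hh (↥(pw k (Hh ⊗[k] Hh) n) ⊗[k] Hh)).symm.toLinearMap
        ∘ₗ (TensorProduct.assoc k Hh Hh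
            (Hh ⊗[k] (↥(pw k (Hh ⊗[k] Hh) n) ⊗[k] Hh))).toLinearMap
        ∘ₗ LinearMap.lTensor (Hh ⊗[k] Hh) (mids c n)

/-- `𝔠_{n+1}` (composed with the regrouping `Hh^{⊗2(n+1)} ≅ Hh^{⊗(n+1)}⊗Hh^{⊗(n+1)}`) :
defined by `𝔠_1 = id` and `𝔠_{n+1} = (id⊗𝔠_n⊗id)∘(id⊗c^{×n}⊗id)`. -/
noncomputable def cShuffle (c : Hh ⊗[k] Hh →ₗ[k] Hh ⊗[k] Hh) :
    ∀ n : ℕ, ↥(pw k (Hh ⊗[k] Hh) n) →ₗ[k] (↥(pw k Hh n) ⊗[k] ↥(pw k Hh n))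
  | 0 => LinearMap.id
  | n + 1 =>
      (TensorProduct.assoc k Hh ↥(pw k Hh n) ↥(pw k Hh (n + 1))).symm.toLinearMap
        ∘ₗ LinearMap.lTensor Hh (LinearMap.lTensor ↥(pw k Hh n) (snoc k n).toLinearMap)
        ∘ₗ LinearMap.lTensor Hh (TensorProduct.assoc k ↥(pw k Hh n) ↥(pw k Hh n) Hh).toLinearMap
        ∘ₗ LinearMap.lTensor Hh (LinearMap.rTensor Hh (cShuffle c n))
        ∘ₗ mids c n

/-- The comultiplication `Δ_{H^{⊗_c(n+1)}} := 𝔠_{n+1}∘Δ^{⊗(n+1)}` of the braided tensor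
power coalgebra. -/
noncomputable def comulP (c : Hh ⊗[k] Hh →ₗ[k] Hh ⊗[k] Hh) (Δ : Hh →ₗ[k] Hh ⊗[k] Hh)
    (n : ℕ) : ↥(pw k Hh n) →ₗ[k] (↥(pw k Hh n) ⊗[k] ↥(pw k Hh n)) :=
  cShuffle c n ∘ₗ dPow Δ n

/-- The counit `ε^{⊗(n+1)}` of the braided tensor power coalgebra. -/
noncomputable def counitP (ε : Hh →ₗ[k] k) : ∀ n : ℕ, ↥(pw k Hh n) →ₗ[k] k
  | 0 => ε
  | n + 1 => (TensorProduct.lid k k).toLinearMap ∘ₗ TensorProduct.map ε (counitP ε n)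

end ComulPow

/-- A braided bialgebra: an algebra-and-coalgebra `H` together with a bijective braiding
operator `c` compatible with both structures, for which `η` is a coalgebra morphism, `ε` is
an algebra morphism and `Δ∘μ = (μ⊗μ)∘(id⊗c⊗id)∘(Δ⊗Δ)`. -/
structure BraidedBialgebra (H : Type u) [Ring H] [Algebra k H] [Coalgebra k H] where
  /-- the braid -/
  c : H ⊗[k] H ≃ₗ[k] H ⊗[k] H
  /-- `(c⊗id)∘(id⊗c)∘(c⊗id) = (id⊗c)∘(c⊗id)∘(id⊗c)` -/
  yang_baxter :
    LinearMap.rTensor H c.toLinearMap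
        ∘ₗ (TensorProduct.assoc k H H H).symm.toLinearMap
        ∘ₗ LinearMap.lTensor H c.toLinearMap
        ∘ₗ (TensorProduct.assoc k H H H).toLinearMap
        ∘ₗ LinearMap.rTensor H c.toLinearMap
      = (TensorProduct.assoc k H H H).symm.toLinearMap
        ∘ₗ LinearMap.lTensor H c.toLinearMap
        ∘ₗ (TensorProduct.assoc k H H H).toLinearMap
        ∘ₗ LinearMap.rTensor H c.toLinearMap
        ∘ₗ (TensorProduct.assoc k H H H).symm.toLinearMap
        ∘ₗ LinearMap.lTensor H c.toLinearMap
        ∘ₗ (TensorProduct.assoc k H H H).toLinearMap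
  /-- `c(h⊗1) = 1⊗h` -/
  braid_one_right : ∀ h : H, c (h ⊗ₜ[k] (1 : H)) = (1 : H) ⊗ₜ[k] h
  /-- `c(1⊗h) = h⊗1` -/
  braid_one_left : ∀ h : H, c ((1 : H) ⊗ₜ[k] h) = h ⊗ₜ[k] (1 : H)
  /-- `c∘(μ⊗id) = (id⊗μ)∘(c⊗id)∘(id⊗c)` -/
  braid_mul_right :
    c.toLinearMap ∘ₗ LinearMap.rTensor H (LinearMap.mul' k H)
      = LinearMap.lTensor H (LinearMap.mul' k H)
        ∘ₗ (TensorProduct.assoc k H H H).toLinearMap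
        ∘ₗ LinearMap.rTensor H c.toLinearMap
        ∘ₗ (TensorProduct.assoc k H H H).symm.toLinearMap
        ∘ₗ LinearMap.lTensor H c.toLinearMap
        ∘ₗ (TensorProduct.assoc k H H H).toLinearMap
  /-- `c∘(id⊗μ) = (μ⊗id)∘(id⊗c)∘(c⊗id)` -/
  braid_mul_left :
    c.toLinearMap ∘ₗ LinearMap.lTensor H (LinearMap.mul' k H)
      = LinearMap.rTensor H (LinearMap.mul' k H)
        ∘ₗ (TensorProduct.assoc k H H H).symm.toLinearMap
        ∘ₗ LinearMap.lTensor H c.toLinearMap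
        ∘ₗ (TensorProduct.assoc k H H H).toLinearMap
        ∘ₗ LinearMap.rTensor H c.toLinearMap
        ∘ₗ (TensorProduct.assoc k H H H).symm.toLinearMap
  /-- `(id⊗ε)∘c = ε⊗id` -/
  braid_counit_right :
    (TensorProduct.rid k H).toLinearMap
        ∘ₗ LinearMap.lTensor H (Coalgebra.counit (R := k) (A := H))
        ∘ₗ c.toLinearMap
      = (TensorProduct.lid k H).toLinearMap
        ∘ₗ LinearMap.rTensor H (Coalgebra.counit (R := k) (A := H))
  /-- `(ε⊗id)∘c = id⊗ε` -/
  braid_counit_left :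
    (TensorProduct.lid k H).toLinearMap
        ∘ₗ LinearMap.rTensor H (Coalgebra.counit (R := k) (A := H))
        ∘ₗ c.toLinearMap
      = (TensorProduct.rid k H).toLinearMap
        ∘ₗ LinearMap.lTensor H (Coalgebra.counit (R := k) (A := H))
  /-- `(id⊗Δ)∘c = (c⊗id)∘(id⊗c)∘(Δ⊗id)` -/
  braid_comul_right :
    LinearMap.lTensor H (Coalgebra.comul (R := k) (A := H)) ∘ₗ c.toLinearMap
      = (TensorProduct.assoc k H H H).toLinearMap
        ∘ₗ LinearMap.rTensor H c.toLinearMap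
        ∘ₗ (TensorProduct.assoc k H H H).symm.toLinearMap
        ∘ₗ LinearMap.lTensor H c.toLinearMap
        ∘ₗ (TensorProduct.assoc k H H H).toLinearMap
        ∘ₗ LinearMap.rTensor H (Coalgebra.comul (R := k) (A := H))
  /-- `(Δ⊗id)∘c = (id⊗c)∘(c⊗id)∘(id⊗Δ)` -/
  braid_comul_left :
    (TensorProduct.assoc k H H H).toLinearMap
        ∘ₗ LinearMap.rTensor H (Coalgebra.comul (R := k) (A := H))
        ∘ₗ c.toLinearMap
      = LinearMap.lTensor H c.toLinearMap
        ∘ₗ (TensorProduct.assoc k H H H).toLinearMap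
        ∘ₗ LinearMap.rTensor H c.toLinearMap
        ∘ₗ (TensorProduct.assoc k H H H).symm.toLinearMap
        ∘ₗ LinearMap.lTensor H (Coalgebra.comul (R := k) (A := H))
  /-- `Δ(1) = 1⊗1` -/
  comul_one : Coalgebra.comul (R := k) (1 : H) = (1 : H) ⊗ₜ[k] (1 : H)
  /-- `ε(1) = 1` -/
  counit_one : Coalgebra.counit (R := k) (1 : H) = (1 : k)
  /-- `ε(hl) = ε(h)ε(l)` -/
  counit_mul : ∀ h l : H,
    Coalgebra.counit (R := k) (h * l)
      = Coalgebra.counit (R := k) h * Coalgebra.counit (R := k) l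
  /-- `Δ∘μ = (μ⊗μ)∘(id⊗c⊗id)∘(Δ⊗Δ)` -/
  comul_mul :
    (Coalgebra.comul (R := k) (A := H)) ∘ₗ LinearMap.mul' k H
      = TensorProduct.map (LinearMap.mul' k H) (LinearMap.mul' k H)
        ∘ₗ (TensorProduct.assoc k H H (H ⊗[k] H)).symm.toLinearMap
        ∘ₗ LinearMap.lTensor H (TensorProduct.assoc k H H H).toLinearMap
        ∘ₗ LinearMap.lTensor H (LinearMap.rTensor H c.toLinearMap)
        ∘ₗ LinearMap.lTensor H (TensorProduct.assoc k H H H).symm.toLinearMap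
        ∘ₗ (TensorProduct.assoc k H H (H ⊗[k] H)).toLinearMap
        ∘ₗ TensorProduct.map (Coalgebra.comul (R := k) (A := H))
            (Coalgebra.comul (R := k) (A := H))

/-- A transposition of the braided bialgebra `(H, c)` on the algebra `A`: a bijective
twisting map `s : H⊗A → A⊗H` compatible with the bialgebra structure of `H`. -/
structure Transposition {H : Type u} [Ring H] [Algebra k H] [Coalgebra k H]
    (c : H ⊗[k] H ≃ₗ[k] H ⊗[k] H) (A : Type u) [Ring A] [Algebra k A] where
  /-- the underlying bijective linear map -/
  s : H ⊗[k] A ≃ₗ[k] A ⊗[k] H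
  /-- `s(h⊗1_A) = 1_A⊗h` -/
  s_one_right : ∀ h : H, s (h ⊗ₜ[k] (1 : A)) = (1 : A) ⊗ₜ[k] h
  /-- `s(1_H⊗a) = a⊗1_H` -/
  s_one_left : ∀ a : A, s ((1 : H) ⊗ₜ[k] a) = a ⊗ₜ[k] (1 : H)
  /-- `s∘(id_H⊗μ_A) = (μ_A⊗id_H)∘(id_A⊗s)∘(s⊗id_A)` -/
  s_mul_A :
    s.toLinearMap ∘ₗ LinearMap.lTensor H (LinearMap.mul' k A)
      = LinearMap.rTensor H (LinearMap.mul' k A)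
        ∘ₗ (TensorProduct.assoc k A A H).symm.toLinearMap
        ∘ₗ LinearMap.lTensor A s.toLinearMap
        ∘ₗ (TensorProduct.assoc k A H A).toLinearMap
        ∘ₗ LinearMap.rTensor A s.toLinearMap
        ∘ₗ (TensorProduct.assoc k H A A).symm.toLinearMap
  /-- `s∘(μ_H⊗id_A) = (id_A⊗μ_H)∘(s⊗id_H)∘(id_H⊗s)` -/
  s_mul_H :
    s.toLinearMap ∘ₗ LinearMap.rTensor A (LinearMap.mul' k H)
      = LinearMap.lTensor A (LinearMap.mul' k H)
        ∘ₗ (TensorProduct.assoc k A H H).toLinearMap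
        ∘ₗ LinearMap.rTensor H s.toLinearMap
        ∘ₗ (TensorProduct.assoc k H A H).symm.toLinearMap
        ∘ₗ LinearMap.lTensor H s.toLinearMap
        ∘ₗ (TensorProduct.assoc k H H A).toLinearMap
  /-- `(id_A⊗ε_H)∘s = ε_H⊗id_A` -/
  s_counit :
    (TensorProduct.rid k A).toLinearMap
        ∘ₗ LinearMap.lTensor A (Coalgebra.counit (R := k) (A := H))
        ∘ₗ s.toLinearMap
      = (TensorProduct.lid k A).toLinearMap
        ∘ₗ LinearMap.rTensor A (Coalgebra.counit (R := k) (A := H))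
  /-- `(id_A⊗Δ_H)∘s = (s⊗id_H)∘(id_H⊗s)∘(Δ_H⊗id_A)` -/
  s_comul :
    LinearMap.lTensor A (Coalgebra.comul (R := k) (A := H)) ∘ₗ s.toLinearMap
      = (TensorProduct.assoc k A H H).toLinearMap
        ∘ₗ LinearMap.rTensor H s.toLinearMap
        ∘ₗ (TensorProduct.assoc k H A H).symm.toLinearMap
        ∘ₗ LinearMap.lTensor H s.toLinearMap
        ∘ₗ (TensorProduct.assoc k H H A).toLinearMap
        ∘ₗ LinearMap.rTensor A (Coalgebra.comul (R := k) (A := H))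
  /-- `(s⊗id_H)∘(id_H⊗s)∘(c⊗id_A) = (id_A⊗c)∘(s⊗id_H)∘(id_H⊗s)` -/
  s_braid :
    (TensorProduct.assoc k A H H).toLinearMap
        ∘ₗ LinearMap.rTensor H s.toLinearMap
        ∘ₗ (TensorProduct.assoc k H A H).symm.toLinearMap
        ∘ₗ LinearMap.lTensor H s.toLinearMap
        ∘ₗ (TensorProduct.assoc k H H A).toLinearMap
        ∘ₗ LinearMap.rTensor A c.toLinearMap
      = LinearMap.lTensor A c.toLinearMap
        ∘ₗ (TensorProduct.assoc k A H H).toLinearMap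
        ∘ₗ LinearMap.rTensor H s.toLinearMap
        ∘ₗ (TensorProduct.assoc k H A H).symm.toLinearMap
        ∘ₗ LinearMap.lTensor H s.toLinearMap
        ∘ₗ (TensorProduct.assoc k H H A).toLinearMap

/-- A weak `s`-action of the braided bialgebra `(H, c)` on the algebra `A`. -/
structure WeakSAction {H A : Type u} [Ring H] [Algebra k H] [Coalgebra k H]
    [Ring A] [Algebra k A]
    (c : H ⊗[k] H ≃ₗ[k] H ⊗[k] H) (s : H ⊗[k] A ≃ₗ[k] A ⊗[k] H) where
  /-- the action map -/
  ρ : H ⊗[k] A →ₗ[k] A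
  /-- `ρ∘(id_H⊗μ_A) = μ_A∘(ρ⊗ρ)∘(id_H⊗s⊗id_A)∘(Δ_H⊗id_{A⊗A})` -/
  rho_mul :
    ρ ∘ₗ LinearMap.lTensor H (LinearMap.mul' k A)
      = LinearMap.mul' k A
        ∘ₗ TensorProduct.map ρ ρ
        ∘ₗ (TensorProduct.assoc k H A (H ⊗[k] A)).symm.toLinearMap
        ∘ₗ LinearMap.lTensor H (TensorProduct.assoc k A H A).toLinearMap
        ∘ₗ LinearMap.lTensor H (LinearMap.rTensor A s.toLinearMap)
        ∘ₗ LinearMap.lTensor H (TensorProduct.assoc k H A A).symm.toLinearMap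
        ∘ₗ (TensorProduct.assoc k H H (A ⊗[k] A)).toLinearMap
        ∘ₗ LinearMap.rTensor (A ⊗[k] A) (Coalgebra.comul (R := k) (A := H))
  /-- `ρ(h⊗1_A) = ε(h)1_A` -/
  rho_one : ∀ h : H, ρ (h ⊗ₜ[k] (1 : A)) = Coalgebra.counit (R := k) h • (1 : A)
  /-- `ρ(1_H⊗a) = a` -/
  one_rho : ∀ a : A, ρ ((1 : H) ⊗ₜ[k] a) = a
  /-- `s∘(id_H⊗ρ) = (ρ⊗id_H)∘(id_H⊗s)∘(c⊗id_A)` -/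
  rho_s :
    s.toLinearMap ∘ₗ LinearMap.lTensor H ρ
      = LinearMap.rTensor H ρ
        ∘ₗ (TensorProduct.assoc k H A H).symm.toLinearMap
        ∘ₗ LinearMap.lTensor H s.toLinearMap
        ∘ₗ (TensorProduct.assoc k H H A).toLinearMap
        ∘ₗ LinearMap.rTensor A c.toLinearMap
        ∘ₗ (TensorProduct.assoc k H H A).symm.toLinearMap

variable {k}

/-- The twisting map `χ := (ρ⊗id_H)∘(id_H⊗s)∘(Δ_H⊗id_A)` associated with a braided
Hopf crossed product datum. -/
noncomputable def chi {H A : Type u} [Ring H] [Algebra k H] [Coalgebra k H]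
    [Ring A] [Algebra k A]
    (s : H ⊗[k] A →ₗ[k] A ⊗[k] H) (ρ : H ⊗[k] A →ₗ[k] A) :
    H ⊗[k] A →ₗ[k] A ⊗[k] H :=
  LinearMap.rTensor H ρ
    ∘ₗ (TensorProduct.assoc k H A H).symm.toLinearMap
    ∘ₗ LinearMap.lTensor H s
    ∘ₗ (TensorProduct.assoc k H H A).toLinearMap
    ∘ₗ LinearMap.rTensor A (Coalgebra.comul (R := k) (A := H))


section StringDiagrams

open CategoryTheory MonoidalCategory

variable {C : Type*} [Category C] [MonoidalCategory C]

/-- Compatibility of a twisting map `χ` with a comultiplication `Δ`, up to a second twist `s`: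
`(id⊗Δ)∘χ = (χ⊗id)∘(id⊗s)∘(Δ⊗id)`. -/
def ComulTwist {X V : C} (Δ : X ⟶ X ⊗ X) (χ s : X ⊗ V ⟶ V ⊗ X) : Prop :=
  χ ≫ V ◁ Δ = Δ ▷ V ≫ (α_ X X V).hom ≫ X ◁ s ≫ (α_ X V X).inv ≫ χ ▷ X ≫ (α_ V X X).hom

/-- Compatibility of twisting maps `s` and `χ` with a braid `c`:
`(id⊗c)∘(s⊗id)∘(id⊗χ) = (χ⊗id)∘(id⊗s)∘(c⊗id)`. -/
def BraidTwist {Y X V : C} (c : Y ⊗ X ⟶ X ⊗ Y) (s : Y ⊗ V ⟶ V ⊗ Y) (χ : X ⊗ V ⟶ V ⊗ X) :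
    Prop :=
  (α_ Y X V).hom ≫ Y ◁ χ ≫ (α_ Y V X).inv ≫ s ▷ X ≫ (α_ V Y X).hom ≫ V ◁ c =
    c ▷ V ≫ (α_ X Y V).hom ≫ X ◁ s ≫ (α_ X V Y).inv ≫ χ ▷ Y ≫ (α_ V X Y).hom

/-- The twist of `X` past `V' ≅ V ⊗ W` built from twists past `V` and past `W`. -/
def twistTensor {X V W V' : C} (e : V ⊗ W ≅ V') (f : X ⊗ V ⟶ V ⊗ X) (g : X ⊗ W ⟶ W ⊗ X) :
    X ⊗ V' ⟶ V' ⊗ X :=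
  X ◁ e.inv ≫ (α_ X V W).inv ≫ f ▷ W ≫ (α_ V X W).hom ≫ V ◁ g ≫ (α_ V W X).inv ≫ e.hom ▷ X

/-- The twist of `Y ⊗ X` past `V` built from twists of `Y` and of `X`. -/
def tensorTwist {Y X V : C} (f : Y ⊗ V ⟶ V ⊗ Y) (g : X ⊗ V ⟶ V ⊗ X) :
    (Y ⊗ X) ⊗ V ⟶ V ⊗ (Y ⊗ X) :=
  (α_ Y X V).hom ≫ Y ◁ g ≫ (α_ Y V X).inv ≫ f ▷ X ≫ (α_ V Y X).hom

/-- The twist of `Z` past `Y ⊗ X` built from twists past `Y` and past `X`. -/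
def twistCons {Z Y X : C} (f : Z ⊗ Y ⟶ Y ⊗ Z) (g : Z ⊗ X ⟶ X ⊗ Z) :
    Z ⊗ (Y ⊗ X) ⟶ (Y ⊗ X) ⊗ Z :=
  (α_ Z Y X).inv ≫ f ▷ X ≫ (α_ Y Z X).hom ≫ Y ◁ g ≫ (α_ Y X Z).inv

/-- The shuffle `id ⊗ c ⊗ id` on `(Y⊗Y)⊗(X⊗X)`. -/
def middleSwap {Y X : C} (c : Y ⊗ X ⟶ X ⊗ Y) : (Y ⊗ Y) ⊗ (X ⊗ X) ⟶ (Y ⊗ X) ⊗ (Y ⊗ X) :=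
  (α_ Y Y (X ⊗ X)).hom ≫ Y ◁ (α_ Y X X).inv ≫ Y ◁ (c ▷ X) ≫ Y ◁ (α_ X Y X).hom ≫
    (α_ Y X (Y ⊗ X)).inv

theorem ComulTwist.twistTensor {X V W V' : C} {Δ : X ⟶ X ⊗ X} {χ s : X ⊗ V ⟶ V ⊗ X}
    {χ' s' : X ⊗ W ⟶ W ⊗ X} (e : V ⊗ W ≅ V') (h : ComulTwist Δ χ s) (h' : ComulTwist Δ χ' s') :
    ComulTwist Δ (twistTensor e χ χ') (twistTensor e s s') := by
  unfold ComulTwist at *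
  unfold _root_.twistTensor
  calc
    _ = X ◁ e.inv ⊗≫ χ ▷ W ⊗≫ V ◁ χ' ⊗≫ (e.hom ▷ X ≫ V' ◁ Δ) := by
      monoidal
    _ = X ◁ e.inv ⊗≫ χ ▷ W ⊗≫ V ◁ (χ' ≫ W ◁ Δ) ⊗≫ e.hom ▷ X ▷ X ⊗≫ 𝟙 _ := by
      rw [← whisker_exchange]; monoidal
    _ = X ◁ e.inv ⊗≫ (χ ≫ V ◁ Δ) ▷ W ⊗≫ V ◁ X ◁ s' ⊗≫ V ◁ χ' ▷ X ⊗≫ e.hom ▷ X ▷ X ⊗≫ 𝟙 _ := by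
      rw [h']; monoidal
    _ = X ◁ e.inv ⊗≫ Δ ▷ V ▷ W ⊗≫ X ◁ s ▷ W ⊗≫ (χ ▷ (X ⊗ W) ≫ (V ⊗ X) ◁ s') ⊗≫
          V ◁ χ' ▷ X ⊗≫ e.hom ▷ X ▷ X ⊗≫ 𝟙 _ := by
      rw [h]; monoidal
    _ = (X ◁ e.inv ≫ Δ ▷ (V ⊗ W)) ⊗≫ X ◁ s ▷ W ⊗≫ X ◁ V ◁ s' ⊗≫
          (X ◁ (𝟙 (V ⊗ W))) ▷ X ⊗≫ χ ▷ W ▷ X ⊗≫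
          V ◁ χ' ▷ X ⊗≫ e.hom ▷ X ▷ X ⊗≫ 𝟙 _ := by
      rw [← whisker_exchange]; monoidal
    _ = _ := by
      rw [whisker_exchange, ← e.hom_inv_id]; monoidal

theorem BraidTwist.twistTensor {Y X V W V' : C} {c : Y ⊗ X ⟶ X ⊗ Y}
    {s : Y ⊗ V ⟶ V ⊗ Y} {χ : X ⊗ V ⟶ V ⊗ X} {s' : Y ⊗ W ⟶ W ⊗ Y} {χ' : X ⊗ W ⟶ W ⊗ X}
    (e : V ⊗ W ≅ V') (h : BraidTwist c s χ) (h' : BraidTwist c s' χ') :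
    BraidTwist c (twistTensor e s s') (twistTensor e χ χ') := by
  unfold BraidTwist at *
  unfold _root_.twistTensor
  calc
    _ = 𝟙 _ ⊗≫ (Y ⊗ X) ◁ e.inv ⊗≫ Y ◁ χ ▷ W ⊗≫ Y ◁ V ◁ χ' ⊗≫ (Y ◁ (e.hom ≫ e.inv)) ▷ X ⊗≫
          s ▷ W ▷ X ⊗≫ V ◁ s' ▷ X ⊗≫ (e.hom ▷ (Y ⊗ X) ≫ V' ◁ c) := by
      monoidal
    _ = 𝟙 _ ⊗≫ (Y ⊗ X) ◁ e.inv ⊗≫ Y ◁ χ ▷ W ⊗≫ ((Y ⊗ V) ◁ χ' ≫ s ▷ (W ⊗ X)) ⊗≫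
          V ◁ s' ▷ X ⊗≫ (V ⊗ W) ◁ c ⊗≫ e.hom ▷ (X ⊗ Y) := by
      rw [e.hom_inv_id, ← whisker_exchange]; monoidal
    _ = 𝟙 _ ⊗≫ (Y ⊗ X) ◁ e.inv ⊗≫ Y ◁ χ ▷ W ⊗≫ s ▷ X ▷ W ⊗≫
          V ◁ ((α_ Y X W).hom ≫ Y ◁ χ' ≫ (α_ Y W X).inv ≫ s' ▷ X ≫ (α_ W Y X).hom ≫ W ◁ c) ⊗≫
          e.hom ▷ (X ⊗ Y) := by
      rw [whisker_exchange]; monoidal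
    _ = 𝟙 _ ⊗≫ (Y ⊗ X) ◁ e.inv ⊗≫
          ((α_ Y X V).hom ≫ Y ◁ χ ≫ (α_ Y V X).inv ≫ s ▷ X ≫ (α_ V Y X).hom ≫ V ◁ c) ▷ W ⊗≫
          V ◁ X ◁ s' ⊗≫ V ◁ χ' ▷ Y ⊗≫ e.hom ▷ (X ⊗ Y) := by
      rw [h']; monoidal
    _ = 𝟙 _ ⊗≫ ((Y ⊗ X) ◁ e.inv ≫ c ▷ (V ⊗ W)) ⊗≫ X ◁ s ▷ W ⊗≫
          (χ ▷ (Y ⊗ W) ≫ (V ⊗ X) ◁ s') ⊗≫ V ◁ χ' ▷ Y ⊗≫ e.hom ▷ (X ⊗ Y) := by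
      rw [h]; monoidal
    _ = 𝟙 _ ⊗≫ c ▷ V' ⊗≫ X ◁ Y ◁ e.inv ⊗≫ X ◁ s ▷ W ⊗≫ X ◁ V ◁ s' ⊗≫
          (X ◁ (𝟙 (V ⊗ W))) ▷ Y ⊗≫ χ ▷ W ▷ Y ⊗≫ V ◁ χ' ▷ Y ⊗≫ e.hom ▷ X ▷ Y ⊗≫ 𝟙 _ := by
      rw [← whisker_exchange, whisker_exchange c]; monoidal
    _ = _ := by
      rw [← e.hom_inv_id]; monoidal

theorem BraidTwist.twistCons {Z Y X V : C} {c : Z ⊗ Y ⟶ Y ⊗ Z} {c' : Z ⊗ X ⟶ X ⊗ Z}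
    {s : Z ⊗ V ⟶ V ⊗ Z} {χ : Y ⊗ V ⟶ V ⊗ Y} {χ' : X ⊗ V ⟶ V ⊗ X}
    (h : BraidTwist c s χ) (h' : BraidTwist c' s χ') :
    BraidTwist (twistCons c c') s (tensorTwist χ χ') := by
  unfold BraidTwist at *
  unfold _root_.twistCons tensorTwist
  calc
    _ = 𝟙 _ ⊗≫ Z ◁ Y ◁ χ' ⊗≫
          ((α_ Z Y V).hom ≫ Z ◁ χ ≫ (α_ Z V Y).inv ≫ s ▷ Y ≫ (α_ V Z Y).hom ≫ V ◁ c) ▷ X ⊗≫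
          V ◁ Y ◁ c' ⊗≫ 𝟙 _ := by
      monoidal
    _ = 𝟙 _ ⊗≫ ((Z ⊗ Y) ◁ χ' ≫ c ▷ (V ⊗ X)) ⊗≫ Y ◁ s ▷ X ⊗≫
          (χ ▷ (Z ⊗ X) ≫ (V ⊗ Y) ◁ c') ⊗≫ 𝟙 _ := by
      rw [h]; monoidal
    _ = 𝟙 _ ⊗≫ c ▷ X ▷ V ⊗≫
          Y ◁ ((α_ Z X V).hom ≫ Z ◁ χ' ≫ (α_ Z V X).inv ≫ s ▷ X ≫ (α_ V Z X).hom ≫ V ◁ c') ⊗≫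
          χ ▷ X ▷ Z ⊗≫ 𝟙 _ := by
      rw [whisker_exchange, ← whisker_exchange χ]; monoidal
    _ = _ := by
      rw [h']; monoidal

theorem ComulTwist.tensorTwist {Y X V : C} {Δ : Y ⟶ Y ⊗ Y} {Δ' : X ⟶ X ⊗ X}
    {c : Y ⊗ X ⟶ X ⊗ Y} {χ s : Y ⊗ V ⟶ V ⊗ Y} {χ' s' : X ⊗ V ⟶ V ⊗ X}
    (h : ComulTwist Δ χ s) (h' : ComulTwist Δ' χ' s') (hc : BraidTwist c s χ') :
    ComulTwist ((Δ ⊗ₘ Δ') ≫ middleSwap c) (tensorTwist χ χ') (tensorTwist s s') := by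
  unfold ComulTwist BraidTwist at *
  unfold _root_.tensorTwist middleSwap
  calc
    _ = 𝟙 _ ⊗≫ Y ◁ χ' ⊗≫ (χ ▷ X ≫ (V ⊗ Y) ◁ Δ') ⊗≫ V ◁ Δ ▷ (X ⊗ X) ⊗≫
          V ◁ Y ◁ c ▷ X ⊗≫ 𝟙 _ := by
      rw [tensorHom_def']; monoidal
    _ = 𝟙 _ ⊗≫ Y ◁ (χ' ≫ V ◁ Δ') ⊗≫ (χ ≫ V ◁ Δ) ▷ (X ⊗ X) ⊗≫ V ◁ Y ◁ c ▷ X ⊗≫ 𝟙 _ := by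
      rw [← whisker_exchange]; monoidal
    _ = 𝟙 _ ⊗≫ Y ◁ (Δ' ▷ V) ⊗≫ Y ◁ X ◁ s' ⊗≫ (Y ◁ (χ' ▷ X) ⊗≫ Δ ▷ V ▷ (X ⊗ X)) ⊗≫
          Y ◁ s ▷ (X ⊗ X) ⊗≫ (χ ▷ (Y ⊗ X) ≫ (V ⊗ Y) ◁ c) ▷ X ⊗≫ 𝟙 _ := by
      rw [h, h']; monoidal
    _ = 𝟙 _ ⊗≫ Y ◁ (Δ' ▷ V) ⊗≫ (Y ◁ (X ◁ s' ≫ (α_ X V X).inv ≫ χ' ▷ X) ≫ Δ ▷ ((V ⊗ X) ⊗ X)) ⊗≫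
          Y ◁ s ▷ (X ⊗ X) ⊗≫ Y ◁ V ◁ c ▷ X ⊗≫ χ ▷ (X ⊗ Y) ▷ X ⊗≫ 𝟙 _ := by
      rw [← whisker_exchange]; monoidal
    _ = 𝟙 _ ⊗≫ Y ◁ (Δ' ▷ V) ⊗≫ Δ ▷ (X ⊗ X ⊗ V) ⊗≫ Y ◁ Y ◁ X ◁ s' ⊗≫
          Y ◁ ((α_ Y X V).hom ≫ Y ◁ χ' ≫ (α_ Y V X).inv ≫ s ▷ X ≫ (α_ V Y X).hom ≫ V ◁ c) ▷ X ⊗≫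
          χ ▷ X ▷ Y ▷ X ⊗≫ 𝟙 _ := by
      rw [whisker_exchange]; monoidal
    _ = 𝟙 _ ⊗≫ Y ◁ (Δ' ▷ V) ⊗≫ Δ ▷ (X ⊗ X ⊗ V) ⊗≫ Y ◁ ((Y ⊗ X) ◁ s' ≫ c ▷ (V ⊗ X)) ⊗≫
          Y ◁ X ◁ s ▷ X ⊗≫ Y ◁ χ' ▷ Y ▷ X ⊗≫ χ ▷ X ▷ Y ▷ X ⊗≫ 𝟙 _ := by
      rw [hc]; monoidal
    _ = _ := by
      rw [whisker_exchange, tensorHom_def']; monoidal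

/-- The twist `(ρ⊗id)∘(id⊗s)∘(Δ⊗id)` induced by an action `ρ`. -/
def actionTwist {X V : C} (Δ : X ⟶ X ⊗ X) (s : X ⊗ V ⟶ V ⊗ X) (ρ : X ⊗ V ⟶ V) :
    X ⊗ V ⟶ V ⊗ X :=
  Δ ▷ V ≫ (α_ X X V).hom ≫ X ◁ s ≫ (α_ X V X).inv ≫ ρ ▷ X

theorem ComulTwist.actionTwist {X V : C} {Δ : X ⟶ X ⊗ X} {s : X ⊗ V ⟶ V ⊗ X} (ρ : X ⊗ V ⟶ V)
    (hΔ : Δ ≫ Δ ▷ X ≫ (α_ X X X).hom = Δ ≫ X ◁ Δ) (hs : ComulTwist Δ s s) :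
    ComulTwist Δ (actionTwist Δ s ρ) s := by
  unfold ComulTwist at *
  unfold _root_.actionTwist
  calc
    _ = 𝟙 _ ⊗≫ Δ ▷ V ⊗≫ X ◁ s ⊗≫ (ρ ▷ X ≫ V ◁ Δ) := by monoidal
    _ = 𝟙 _ ⊗≫ Δ ▷ V ⊗≫ X ◁ (s ≫ V ◁ Δ) ⊗≫ ρ ▷ (X ⊗ X) := by
      rw [← whisker_exchange]; monoidal
    _ = 𝟙 _ ⊗≫ (Δ ≫ X ◁ Δ) ▷ V ⊗≫ X ◁ X ◁ s ⊗≫ X ◁ s ▷ X ⊗≫ ρ ▷ (X ⊗ X) := by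
      rw [hs]; monoidal
    _ = 𝟙 _ ⊗≫ Δ ▷ V ⊗≫ (Δ ▷ (X ⊗ V) ≫ (X ⊗ X) ◁ s) ⊗≫ X ◁ s ▷ X ⊗≫ ρ ▷ (X ⊗ X) := by
      rw [← hΔ]; monoidal
    _ = _ := by
      rw [← whisker_exchange]; monoidal

theorem BraidTwist.actionTwist {X V : C} {Δ : X ⟶ X ⊗ X} {c : X ⊗ X ⟶ X ⊗ X}
    {s : X ⊗ V ⟶ V ⊗ X} {ρ : X ⊗ V ⟶ V}
    (hc : c ≫ Δ ▷ X ≫ (α_ X X X).hom =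
      X ◁ Δ ≫ (α_ X X X).inv ≫ c ▷ X ≫ (α_ X X X).hom ≫ X ◁ c)
    (hs : BraidTwist c s s)
    (hρ : X ◁ ρ ≫ s = (α_ X X V).inv ≫ c ▷ V ≫ (α_ X X V).hom ≫ X ◁ s ≫ (α_ X V X).inv ≫ ρ ▷ X) :
    BraidTwist c s (actionTwist Δ s ρ) := by
  unfold BraidTwist at *
  unfold _root_.actionTwist
  calc
    _ = 𝟙 _ ⊗≫ X ◁ Δ ▷ V ⊗≫ X ◁ X ◁ s ⊗≫ (X ◁ ρ ≫ s) ▷ X ⊗≫ V ◁ c := by monoidal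
    _ = 𝟙 _ ⊗≫ X ◁ Δ ▷ V ⊗≫ ((X ⊗ X) ◁ s ≫ c ▷ (V ⊗ X)) ⊗≫ X ◁ s ▷ X ⊗≫
          (ρ ▷ (X ⊗ X) ≫ V ◁ c) := by
      rw [hρ]; monoidal
    _ = 𝟙 _ ⊗≫ X ◁ Δ ▷ V ⊗≫ c ▷ X ▷ V ⊗≫
          X ◁ ((α_ X X V).hom ≫ X ◁ s ≫ (α_ X V X).inv ≫ s ▷ X ≫ (α_ V X X).hom ≫ V ◁ c) ⊗≫
          ρ ▷ (X ⊗ X) := by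
      rw [whisker_exchange, ← whisker_exchange ρ]; monoidal
    _ = 𝟙 _ ⊗≫ (X ◁ Δ ≫ (α_ X X X).inv ≫ c ▷ X ≫ (α_ X X X).hom ≫ X ◁ c) ▷ V ⊗≫
          X ◁ X ◁ s ⊗≫ X ◁ s ▷ X ⊗≫ ρ ▷ (X ⊗ X) := by
      rw [hs]; monoidal
    _ = 𝟙 _ ⊗≫ c ▷ V ⊗≫ (Δ ▷ (X ⊗ V) ≫ (X ⊗ X) ◁ s) ⊗≫ X ◁ s ▷ X ⊗≫ ρ ▷ (X ⊗ X) := by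
      rw [← hc]; monoidal
    _ = _ := by
      rw [← whisker_exchange]; monoidal

theorem whiskerLeft_id_middleSwap {X : C} (c : X ⊗ X ⟶ X ⊗ X) :
    (X ⊗ X) ◁ 𝟙 (X ⊗ X) ≫ middleSwap c =
      ((α_ X X (X ⊗ X)).hom ≫ X ◁ (α_ X X X).inv ≫ X ◁ (c ▷ X)) ≫
        X ◁ (𝟙 (X ⊗ X) ▷ X) ≫ X ◁ (α_ X X X).hom ≫ X ◁ (X ◁ 𝟙 (X ⊗ X)) ≫
        (α_ X X (X ⊗ X)).inv := by
  simp [middleSwap]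

theorem shuffle_eq_middleSwap {H X P : C} {c : H ⊗ H ⟶ H ⊗ H} {c' : H ⊗ X ⟶ X ⊗ H}
    {m : (H ⊗ H) ⊗ P ⟶ H ⊗ (P ⊗ H)} {f : P ⟶ X ⊗ X} {j : X ⊗ H ⟶ H ⊗ X}
    {g : (H ⊗ H) ⊗ P ⟶ (H ⊗ X) ⊗ (H ⊗ X)}
    (hg : g = m ≫ H ◁ (f ▷ H) ≫ H ◁ (α_ X X H).hom ≫ H ◁ (X ◁ j) ≫ (α_ H X (H ⊗ X)).inv)
    (hg' : g = (H ⊗ H) ◁ f ≫ middleSwap c') :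
    ((H ⊗ H) ◁ m ≫ (α_ H H (H ⊗ (P ⊗ H))).hom ≫ H ◁ (α_ H H (P ⊗ H)).inv ≫
        H ◁ (c ▷ (P ⊗ H)) ≫ H ◁ (α_ (H ⊗ H) P H).inv) ≫
      H ◁ (g ▷ H) ≫
      H ◁ (α_ (H ⊗ X) (H ⊗ X) H).hom ≫ H ◁ ((H ⊗ X) ◁ ((α_ H X H).hom ≫ H ◁ j)) ≫
      (α_ H (H ⊗ X) (H ⊗ (H ⊗ X))).inv =
    (H ⊗ H) ◁ g ≫ middleSwap (twistCons c c') := by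
  calc
    _ = 𝟙 _ ⊗≫ H ◁ H ◁ m ⊗≫ H ◁ (c ▷ (P ⊗ H) ≫ (H ⊗ H) ◁ (f ▷ H)) ⊗≫
          H ◁ H ◁ (c' ▷ (X ⊗ H) ≫ (X ⊗ H) ◁ j) ⊗≫ 𝟙 _ := by
      rw [hg', middleSwap]; monoidal
    _ = 𝟙 _ ⊗≫ H ◁ H ◁ m ⊗≫ H ◁ H ◁ H ◁ f ▷ H ⊗≫ H ◁ (c ▷ (X ⊗ X ⊗ H) ≫ (H ⊗ H) ◁ (X ◁ j)) ⊗≫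
          H ◁ H ◁ (c' ▷ (H ⊗ X)) ⊗≫ 𝟙 _ := by
      rw [← whisker_exchange, ← whisker_exchange]; monoidal
    _ = _ := by
      rw [← whisker_exchange, hg, middleSwap, twistCons]; monoidal

end StringDiagrams

section LinearTwists

open CategoryTheory MonoidalCategory

variable {H A V : Type u} [AddCommGroup H] [Module k H] [AddCommGroup A] [Module k A]
  [AddCommGroup V] [Module k V]

/-- The isomorphism of `k`-modules underlying `snoc`. -/
noncomputable def snocIso (A : Type u) [AddCommGroup A] [Module k A] (l : ℕ) :
    ModuleCat.of k ↥(pw k A l) ⊗ ModuleCat.of k A ≅ ModuleCat.of k ↥(pw k A (l + 1)) :=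
  (snoc k l).toModuleIso

theorem twE1_toLinearMap (s : H ⊗[k] A ≃ₗ[k] A ⊗[k] H) (l : ℕ) :
    (twE1 s l).toLinearMap = tw1 s.toLinearMap l := by
  induction l with
  | zero => rfl
  | succ l ih => rw [tw1, ← ih]; rfl

theorem twEFull_toLinearMap (s : H ⊗[k] A ≃ₗ[k] A ⊗[k] H) (j l : ℕ) :
    (twEFull s j l).toLinearMap = twFull s.toLinearMap j l := by
  induction j with
  | zero => exact twE1_toLinearMap s l
  | succ j ih => rw [twFull, ← ih, ← twE1_toLinearMap]; rfl

/-- A twisting map of `H` past `V` as a morphism of the monoidal category of `k`-modules. -/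
noncomputable def twistHom (t : H ⊗[k] V →ₗ[k] V ⊗[k] H) :
    ModuleCat.of k H ⊗ ModuleCat.of k V ⟶ ModuleCat.of k V ⊗ ModuleCat.of k H :=
  ModuleCat.ofHom t

/-- A comultiplication as a morphism of the monoidal category of `k`-modules. -/
noncomputable def comulHom (Δ : H →ₗ[k] H ⊗[k] H) :
    ModuleCat.of k H ⟶ ModuleCat.of k H ⊗ ModuleCat.of k H :=
  ModuleCat.ofHom Δ

/-- The twist of `H` past `H^{⊗(n+1)}` induced by a braid `c`, by recursion on the left factor. -/
noncomputable def braidPow (c : H ⊗[k] H →ₗ[k] H ⊗[k] H) :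
    ∀ n : ℕ, ModuleCat.of k H ⊗ ModuleCat.of k ↥(pw k H n) ⟶
      ModuleCat.of k ↥(pw k H n) ⊗ ModuleCat.of k H
  | 0 => twistHom c
  | n + 1 => twistCons (twistHom c) (braidPow c n)

/-- `cShuffle` as a morphism of the monoidal category of `k`-modules. -/
noncomputable def shuffleHom (c : H ⊗[k] H →ₗ[k] H ⊗[k] H) (n : ℕ) :
    ModuleCat.of k ↥(pw k (H ⊗[k] H) n) ⟶
      ModuleCat.of k ↥(pw k H n) ⊗ ModuleCat.of k ↥(pw k H n) :=
  ModuleCat.ofHom (cShuffle c n)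

/-- `mids` as a morphism of the monoidal category of `k`-modules. -/
noncomputable def midsHom (c : H ⊗[k] H →ₗ[k] H ⊗[k] H) (n : ℕ) :
    (ModuleCat.of k H ⊗ ModuleCat.of k H) ⊗ ModuleCat.of k ↥(pw k (H ⊗[k] H) n) ⟶
      ModuleCat.of k H ⊗ (ModuleCat.of k ↥(pw k (H ⊗[k] H) n) ⊗ ModuleCat.of k H) :=
  ModuleCat.ofHom (mids c n)

/-- `cShuffle c (n + 1)` as a morphism between explicit tensor products. -/
noncomputable def shuffleSuccHom (c : H ⊗[k] H →ₗ[k] H ⊗[k] H) (n : ℕ) :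
    (ModuleCat.of k H ⊗ ModuleCat.of k H) ⊗ ModuleCat.of k ↥(pw k (H ⊗[k] H) n) ⟶
      (ModuleCat.of k H ⊗ ModuleCat.of k ↥(pw k H n)) ⊗
        (ModuleCat.of k H ⊗ ModuleCat.of k ↥(pw k H n)) :=
  ModuleCat.ofHom (cShuffle c (n + 1))

theorem shuffleSuccHom_eq (c : H ⊗[k] H →ₗ[k] H ⊗[k] H) (n : ℕ) :
    shuffleSuccHom c n =
      midsHom c n ≫ ModuleCat.of k H ◁ (shuffleHom c n ▷ ModuleCat.of k H) ≫
        ModuleCat.of k H ◁ (α_ _ _ _).hom ≫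
        ModuleCat.of k H ◁ (ModuleCat.of k ↥(pw k H n) ◁ (snocIso H n).hom) ≫
        (α_ (ModuleCat.of k H) (ModuleCat.of k ↥(pw k H n))
          (ModuleCat.of k H ⊗ ModuleCat.of k ↥(pw k H n))).inv :=
  rfl

theorem shuffleSuccHom_eq_middleSwap (c : H ⊗[k] H →ₗ[k] H ⊗[k] H) (n : ℕ) :
    shuffleSuccHom c n =
      (ModuleCat.of k H ⊗ ModuleCat.of k H) ◁ shuffleHom c n ≫ middleSwap (braidPow c n) := by
  induction n with
  | zero => exact (whiskerLeft_id_middleSwap (twistHom c)).symm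
  | succ n ih =>
    exact shuffle_eq_middleSwap (c := twistHom c) (c' := braidPow c n) (m := midsHom c n)
      (f := shuffleHom c n) (j := (snocIso H n).hom) (g := shuffleSuccHom c n)
      (shuffleSuccHom_eq c n) ih

theorem comulHom_comulP_succ (c : H ⊗[k] H →ₗ[k] H ⊗[k] H) (Δ : H →ₗ[k] H ⊗[k] H) (n : ℕ) :
    comulHom (comulP c Δ (n + 1)) =
      (comulHom Δ ⊗ₘ comulHom (comulP c Δ n)) ≫ middleSwap (braidPow c n) := by
  have h : (comulHom Δ ⊗ₘ ModuleCat.ofHom (dPow Δ n)) ≫ shuffleSuccHom c n =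
      (comulHom Δ ⊗ₘ (ModuleCat.ofHom (dPow Δ n) ≫ shuffleHom c n)) ≫
        middleSwap (braidPow c n) := by
    rw [shuffleSuccHom_eq_middleSwap, ← Category.assoc, ← id_tensorHom,
      tensorHom_comp_tensorHom, Category.comp_id]
  exact h

theorem ComulTwist.tw1 {Δ : H →ₗ[k] H ⊗[k] H} {χ s : H ⊗[k] A →ₗ[k] A ⊗[k] H}
    (h : ComulTwist (comulHom Δ) (twistHom χ) (twistHom s)) (l : ℕ) :
    ComulTwist (comulHom Δ) (twistHom (tw1 χ l)) (twistHom (tw1 s l)) := by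
  induction l with
  | zero => exact h
  | succ l ih => exact ih.twistTensor (snocIso A l) h

theorem BraidTwist.tw1 {c : H ⊗[k] H →ₗ[k] H ⊗[k] H} {χ s : H ⊗[k] A →ₗ[k] A ⊗[k] H}
    (h : BraidTwist (twistHom c) (twistHom s) (twistHom χ)) (l : ℕ) :
    BraidTwist (twistHom c) (twistHom (tw1 s l)) (twistHom (tw1 χ l)) := by
  induction l with
  | zero => exact h
  | succ l ih => exact ih.twistTensor (snocIso A l) h

theorem BraidTwist.twFull {c : H ⊗[k] H →ₗ[k] H ⊗[k] H} {χ s : H ⊗[k] A →ₗ[k] A ⊗[k] H}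
    (h : BraidTwist (twistHom c) (twistHom s) (twistHom χ)) (n l : ℕ) :
    BraidTwist (braidPow c n) (twistHom (_root_.tw1 s l)) (twistHom (twFull χ n l)) := by
  induction n with
  | zero => exact h.tw1 l
  | succ n ih => exact (h.tw1 l).twistCons ih

theorem ComulTwist.twFull {c : H ⊗[k] H →ₗ[k] H ⊗[k] H} {Δ : H →ₗ[k] H ⊗[k] H}
    {χ s : H ⊗[k] A →ₗ[k] A ⊗[k] H}
    (h : ComulTwist (comulHom Δ) (twistHom χ) (twistHom s))
    (hc : BraidTwist (twistHom c) (twistHom s) (twistHom χ)) (n l : ℕ) :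
    ComulTwist (comulHom (comulP c Δ n)) (twistHom (twFull χ n l)) (twistHom (twFull s n l)) := by
  induction n with
  | zero => exact h.tw1 l
  | succ n ih =>
    rw [comulHom_comulP_succ]
    exact (h.tw1 l).tensorTwist ih (hc.twFull n l)

end LinearTwists

/-- `(id⊗Δ_n)∘χ_{n,r} = (χ_{n,r}⊗id)∘(id⊗𝔰_{n,r})∘(Δ_n⊗id)`. -/
theorem comul_chiFull_eq {H A : Type u} [Ring H] [Algebra k H] [Coalgebra k H]
    [Ring A] [Algebra k A]
    (bb : BraidedBialgebra k H) (tr : Transposition k bb.c A)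
    (wa : WeakSAction k bb.c tr.s) :
    ∀ n r : ℕ,
      LinearMap.lTensor ↥(pw k A r)
          (comulP bb.c.toLinearMap (Coalgebra.comul (R := k) (A := H)) n)
          ∘ₗ twFull (chi tr.s.toLinearMap wa.ρ) n r
        = (TensorProduct.assoc k ↥(pw k A r) ↥(pw k H n) ↥(pw k H n)).toLinearMap
          ∘ₗ LinearMap.rTensor ↥(pw k H n) (twFull (chi tr.s.toLinearMap wa.ρ) n r)
          ∘ₗ (TensorProduct.assoc k ↥(pw k H n) ↥(pw k A r) ↥(pw k H n)).symm.toLinearMap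
          ∘ₗ LinearMap.lTensor ↥(pw k H n) (twEFull tr.s n r).toLinearMap
          ∘ₗ (TensorProduct.assoc k ↥(pw k H n) ↥(pw k H n) ↥(pw k A r)).toLinearMap
          ∘ₗ LinearMap.rTensor ↥(pw k A r)
              (comulP bb.c.toLinearMap (Coalgebra.comul (R := k) (A := H)) n) := by
  intro n r
  have hcomul : ComulTwist (comulHom (Coalgebra.comul (R := k) (A := H)))
      (twistHom tr.s.toLinearMap) (twistHom tr.s.toLinearMap) :=
    ModuleCat.hom_ext tr.s_comul
  have hbraid : BraidTwist (twistHom bb.c.toLinearMap)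
      (twistHom tr.s.toLinearMap) (twistHom tr.s.toLinearMap) :=
    ModuleCat.hom_ext tr.s_braid.symm
  have hχ := hcomul.actionTwist (ModuleCat.ofHom wa.ρ)
    (ModuleCat.hom_ext Coalgebra.coassoc)
  have hχc := hbraid.actionTwist (Δ := comulHom (Coalgebra.comul (R := k) (A := H)))
    (ρ := ModuleCat.ofHom wa.ρ)
    (ModuleCat.hom_ext bb.braid_comul_left) (ModuleCat.hom_ext wa.rho_s)
  rw [twEFull_toLinearMap]
  exact congrArg ModuleCat.Hom.hom (ComulTwist.twFull (χ := chi tr.s.toLinearMap wa.ρ) hχ hχc n r)
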